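/- arXiv:2603.09719 — 2 statements merged into one kernel-verified Lean document; each statement's English description precedes it below -/
import Mathlib

section
/- For every real number x that is not an integer multiple of π, one has the pointwise Mittag-Leffler expansion 1/sin²(x) = ∑_{n∈ℤ} 1/(x − nπ)², the series converging absolutely. -/
open Real

/-- The Fourier coefficients of `t ↦ exp (i x t)` on `(-1, 1]` are values of the sinc function. -/
lemma fourierCoeffOn_exp_mul_I {x : ℝ} {n : ℤ} (hx : x ≠ n * π) :
    fourierCoeffOn (show (-1 : ℝ) < 1 by norm_num)
      (fun t : ℝ => Complex.exp (x * Complex.I * t)) n =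
      ((Real.sin (x - n * π) / (x - n * π) : ℝ) : ℂ) := by
  have hy : ((x - n * π : ℝ) : ℂ) ≠ 0 := by exact_mod_cast sub_ne_zero.mpr hx
  have hyI : ((x - n * π : ℝ) : ℂ) * Complex.I ≠ 0 := mul_ne_zero hy Complex.I_ne_zero
  have integrand_eq (t : ℝ) : fourier (-n) (t : AddCircle ((1 : ℝ) - -1)) •
      Complex.exp (x * Complex.I * t) =
        Complex.exp (((x - n * π : ℝ) : ℂ) * Complex.I * t) := by
    rw [fourier_coe_apply, smul_eq_mul, ← Complex.exp_add]
    congr 1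
    push_cast
    ring
  rw [fourierCoeffOn_eq_integral]
  simp_rw [integrand_eq]
  rw [integral_exp_mul_complex hyI, Complex.real_smul, Complex.ofReal_div (Real.sin _),
    Complex.ofReal_sin, Complex.sin]
  generalize ((x - n * π : ℝ) : ℂ) = y at hy ⊢
  rw [← sub_eq_zero]
  have hI := Complex.I_ne_zero
  push_cast
  field_simp
  simp only [Complex.I_sq]
  ring_nf

theorem mittagLeffler_csc_sq (x : ℝ) (hx : ∀ n : ℤ, x ≠ n * Real.pi) :
    HasSum (fun n : ℤ => 1 / (x - n * Real.pi) ^ 2) (1 / (Real.sin x) ^ 2) := by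
  have hsin : Real.sin x ≠ 0 := Real.sin_ne_zero_iff.mpr fun n => (hx n).symm
  have norm_exp (t : ℝ) : ‖Complex.exp (x * Complex.I * t)‖ = 1 := by
    rw [mul_right_comm, ← Complex.ofReal_mul, Complex.norm_exp_ofReal_mul_I]
  have hL2 : MeasureTheory.MemLp (fun t : ℝ => Complex.exp (x * Complex.I * t)) 2
      (MeasureTheory.volume.restrict (Set.Ioc (-1) 1)) :=
    .of_bound (by fun_prop) 1 (.of_forall fun t => (norm_exp t).le)
  have parseval := hasSum_sq_fourierCoeffOn (show (-1 : ℝ) < 1 by norm_num) hL2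
  have integral_norm : ((1 : ℝ) - -1)⁻¹ •
      ∫ t : ℝ in -1..1, ‖Complex.exp (x * Complex.I * t)‖ ^ 2 = 1 := by
    simp only [norm_exp]
    norm_num
  rw [integral_norm] at parseval
  refine (parseval.div_const (Real.sin x ^ 2)).congr_fun fun n => ?_
  have hy := sub_ne_zero.mpr (hx n)
  have sin_sq : Real.sin (x - n * π) ^ 2 = Real.sin x ^ 2 := by
    rw [Real.sin_sub_int_mul_pi, mul_pow, ← sq_abs ((-1 : ℝ) ^ n)]
    simp
  rw [fourierCoeffOn_exp_mul_I (hx n), Complex.norm_real, Real.norm_eq_abs, sq_abs, div_pow,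
    sin_sq]
  field_simp
end

section
/- The Dirichlet L-value L(3, χ₋₃) of the nontrivial (quadratic) Dirichlet character modulo 3 equals 4π³/(81√3); explicitly, ∑_{k=0}^{∞} ( 1/(3k+1)³ − 1/(3k+2)³ ) = 4π³/(81√3). -/
open Real

theorem Polynomial.bernoulli_three_eval_one_third :
    (Polynomial.bernoulli 3).eval (1 / 3) = 1 / 27 := by
  simp_rw [Polynomial.bernoulli, Finset.sum_range_succ, Polynomial.eval_add,
    Polynomial.eval_monomial]
  rw [Finset.sum_range_zero, Polynomial.eval_zero, zero_add, _root_.bernoulli_one]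
  rw [bernoulli_eq_bernoulli'_of_ne_one zero_ne_one, bernoulli'_zero,
    bernoulli_eq_bernoulli'_of_ne_one (by decide : 2 ≠ 1), bernoulli'_two,
    bernoulli_eq_bernoulli'_of_ne_one (by decide : 3 ≠ 1), bernoulli'_three]
  norm_num [Nat.choose]

theorem hasSum_one_div_pow_three_mul_sin_two_pi_div_three :
    HasSum (fun n : ℕ => 1 / (n : ℝ) ^ 3 * sin (2 * π * n * (1 / 3))) (2 * π ^ 3 / 81) := by
  convert! hasSum_one_div_nat_pow_mul_sin one_ne_zero
    (⟨by norm_num, by norm_num⟩ : (1 / 3 : ℝ) ∈ Set.Icc 0 1) using 1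
  have h : (1 / 3 : ℝ) = algebraMap ℚ ℝ (1 / 3) := by simp
  rw [h, Nat.mul_one, Polynomial.eval_map, Polynomial.eval₂_at_apply,
    Polynomial.bernoulli_three_eval_one_third]
  norm_num [Nat.factorial]
  ring

theorem sin_two_pi_div_three : sin (2 * π / 3) = √3 / 2 := by
  rw [← sin_pi_sub, ← sin_pi_div_three]
  ring_nf

theorem sin_four_pi_div_three : sin (4 * π / 3) = -(√3 / 2) := by
  rw [← sin_pi_div_three, ← sin_add_pi]
  ring_nf

theorem L3_chi_neg3_value :
    ∑' k : ℕ, (1 / (3 * (k : ℝ) + 1) ^ 3 - 1 / (3 * (k : ℝ) + 2) ^ 3)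
      = 4 * Real.pi ^ 3 / (81 * Real.sqrt 3) := by
  have h := ((Nat.divModEquiv 3).symm.hasSum_iff.mpr
    hasSum_one_div_pow_three_mul_sin_two_pi_div_three).prod_fiberwise
    fun _ => hasSum_fintype _
  have hs : √3 ≠ 0 := by positivity
  have hv : 2 / √3 * (2 * π ^ 3 / 81) = 4 * π ^ 3 / (81 * √3) := by
    field_simp
    norm_num
  rw [← hv, ← (h.mul_left (2 / √3)).tsum_eq]
  refine tsum_congr fun k => ?_
  have h0 : sin (2 * π * (k * 3) * (1 / 3)) = 0 := by
    rw [← sin_nat_mul_pi (2 * k)]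
    push_cast
    ring_nf
  have h1 : sin (2 * π * (k * 3 + 1) * (1 / 3)) = √3 / 2 := by
    rw [← sin_two_pi_div_three, ← sin_add_nat_mul_two_pi (2 * π / 3) k]
    ring_nf
  have h2 : sin (2 * π * (k * 3 + 2) * (1 / 3)) = -(√3 / 2) := by
    rw [← sin_four_pi_div_three, ← sin_add_nat_mul_two_pi (4 * π / 3) k]
    ring_nf
  simp only [Fin.sum_univ_three, Function.comp_apply, Nat.divModEquiv_symm_apply, Fin.val_zero,
    Fin.val_one, Fin.val_two, Nat.cast_add, Nat.cast_mul, Nat.cast_ofNat, Nat.cast_one,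
    Nat.cast_zero, add_zero, h0, h1, h2]
  field_simp
  ring
end
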